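/- Let 0 < α < 1 and x > 0. Then there exists a constant C > 0 such that for every positive integer N, with h = x/N, |h^{3+α} ∑_{k=1}^{N} k^{2+α} − (x^{2+α}/2) h − (x^{3+α}/(3+α) + ((2+α) x^{1+α}/12) h² + ζ(−2−α) h^{3+α})| ≤ C h⁴. Equivalently, the trapezoidal sum of z(t) = (x−t)^{2+α} on [0,x] with N subintervals equals J^α y(x) + ((2+α) x^{1+α}/12) h² + ζ(−2−α) h^{3+α} + O(h⁴), where y(t) = (x−t)^{1+α}. -/

import Mathlib

/-- The Riemann zeta function (analytically continued), viewed as a real-valued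
function of a real argument. -/
noncomputable def zetaR (s : ℝ) : ℝ := (riemannZeta (s : ℂ)).re

open Complex Filter Topology
lemma P_deriv (a t : ℝ) (c c' : ℂ) (h : 0 < a + t) (hc : c' = c - 1) :
    HasDerivAt (fun t : ℝ => ((a + t : ℝ) : ℂ) ^ c) (c * ((a + t : ℝ) : ℂ) ^ c') t := by
  subst hc
  have h1 : HasDerivAt (fun z : ℂ => (a : ℂ) + z) 1 (t : ℂ) := (hasDerivAt_id (t : ℂ)).const_add _
  have h2 := h1.cpow_const (c := c) (Or.inl (by simpa using h))
  simpa using h2.comp_ofReal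

/-- Mean value step on `[0,1]`. -/
lemma mv_step (G G' : ℝ → ℂ) (M : ℝ) (h0 : G 0 = 0)
    (hd : ∀ t ∈ Set.Icc (0:ℝ) 1, HasDerivAt G (G' t) t)
    (hb : ∀ t ∈ Set.Icc (0:ℝ) 1, ‖G' t‖ ≤ M) : ∀ t ∈ Set.Icc (0:ℝ) 1, ‖G t‖ ≤ M := by
  intro t ht
  have hM : 0 ≤ M := (norm_nonneg _).trans (hb t ht)
  have := (convex_Icc (0:ℝ) 1).norm_image_sub_le_of_norm_hasDerivWithin_le
    (fun u hu => (hd u hu).hasDerivWithinAt) hb (Set.left_mem_Icc.2 zero_le_one) ht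
  rw [h0, sub_zero, sub_zero, Real.norm_of_nonneg ht.1] at this
  nlinarith [ht.2]

noncomputable def emF (a : ℝ) (s : ℂ) : ℂ :=
  (a : ℂ) ^ (1 - s) / (1 - s) + (a : ℂ) ^ (-s) / 2 - s / 12 * (a : ℂ) ^ (-s - 1)

noncomputable def emD (a : ℝ) (s : ℂ) : ℂ :=
  ((a + 1 : ℝ) : ℂ) ^ (-s) - emF (a + 1) s + emF a s

lemma emD_bound (a : ℝ) (ha : 1 ≤ a) (s : ℂ) (hs : s ≠ 1) (R σ : ℝ) (hR : ‖s‖ + 3 ≤ R)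
    (hσ : σ ≤ s.re) (hσ3 : -3 < σ) : ‖emD a s‖ ≤ R ^ 4 * a ^ (-σ - 4) := by
  have hs' : 1 - s ≠ 0 := sub_ne_zero.2 (Ne.symm hs)
  have hpos : ∀ t ∈ Set.Icc (0:ℝ) 1, 0 < a + t := fun t ht => by linarith [ht.1]
  set P : ℂ → ℝ → ℂ := fun c t => ((a + t : ℝ) : ℂ) ^ c with hP
  set M : ℝ := R ^ 4 * a ^ (-σ - 4) with hM
  set G3 : ℝ → ℂ := fun t => -((t:ℂ) ^ 2 / 12) * (s * (s + 1) * (s + 2) * (s + 3) * P (-s - 4) t) with hG3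
  set G2 : ℝ → ℂ := fun t => (-s * P (-s - 1) 0 - (-s) * P (-s - 1) t) / 6
    + (t:ℂ) / 6 * (s * (s + 1) * P (-s - 2) t)
    - (t:ℂ) ^ 2 / 12 * (-(s * (s + 1) * (s + 2)) * P (-s - 3) t) with hG2
  set G1 : ℝ → ℂ := fun t => (P (-s) 0 - P (-s) t) / 2 + (t:ℂ) / 3 * (-s * P (-s - 1) t)
    + (t:ℂ) / 6 * (-s * P (-s - 1) 0) - (t:ℂ) ^ 2 / 12 * (s * (s + 1) * P (-s - 2) t) with hG1
  set G0 : ℝ → ℂ := fun t => (t:ℂ) / 2 * (P (-s) 0 + P (-s) t)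
    - (P (1 - s) t / (1 - s) - P (1 - s) 0 / (1 - s))
    - (t:ℂ) ^ 2 / 12 * (-s * P (-s - 1) t - (-s) * P (-s - 1) 0) with hG0
  have dt : ∀ t : ℝ, HasDerivAt (fun t : ℝ => (t : ℂ)) 1 t := fun t => by
    simpa using (hasDerivAt_id t).ofReal_comp
  have dt2 : ∀ t : ℝ, HasDerivAt (fun t : ℝ => (t : ℂ) ^ 2) (2 * t) t := fun t => by
    simpa using (hasDerivAt_pow 2 (t : ℂ)).comp_ofReal
  have dP : ∀ (c c' : ℂ), c' = c - 1 → ∀ t ∈ Set.Icc (0:ℝ) 1, HasDerivAt (P c) (c * P c' t) t :=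
    fun c c' hc t ht => P_deriv a t c c' (hpos t ht) hc
  have b3 : ∀ t ∈ Set.Icc (0:ℝ) 1, ‖G3 t‖ ≤ M := by
    intro t ht
    have hp : ‖P (-s - 4) t‖ ≤ a ^ (-σ - 4) := by
      simp only [hP]
      rw [norm_cpow_eq_rpow_re_of_pos (hpos t ht)]
      simp only [sub_re, neg_re]
      calc (a + t) ^ (-s.re - (4:ℂ).re) ≤ (a + t) ^ (-σ - 4) := by
            apply Real.rpow_le_rpow_of_exponent_le (by linarith [ht.1])
            simp; linarith
        _ ≤ a ^ (-σ - 4) := Real.rpow_le_rpow_of_nonpos (by linarith) (by linarith [ht.1]) (by linarith)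
    have n0 := norm_nonneg s
    have q0 : ‖s‖ ≤ R := by linarith
    have q1 : ‖s + 1‖ ≤ R := (norm_add_le _ _).trans (by norm_num; linarith)
    have q2 : ‖s + 2‖ ≤ R := (norm_add_le _ _).trans (by norm_num; linarith)
    have q3 : ‖s + 3‖ ≤ R := (norm_add_le _ _).trans (by norm_num; linarith)
    have q4 : ‖-((t:ℂ) ^ 2 / 12)‖ ≤ 1 := by
      rw [norm_neg, norm_div, norm_pow, norm_real, Real.norm_of_nonneg ht.1]
      norm_num
      nlinarith [ht.1, ht.2]
    have hR0 : 0 ≤ R := n0.trans q0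
    simp only [hG3, norm_mul]
    calc _ ≤ 1 * (R * R * R * R * a ^ (-σ - 4)) := by gcongr
      _ = M := by rw [hM]; ring
  have b2 : ∀ t ∈ Set.Icc (0:ℝ) 1, ‖G2 t‖ ≤ M := by
    refine mv_step G2 G3 M (by simp [hG2]) (fun t ht => ?_) b3
    have e1 := dP (-s - 1) (-s - 2) (by ring) t ht
    have e2 := dP (-s - 2) (-s - 3) (by ring) t ht
    have e3 := dP (-s - 3) (-s - 4) (by ring) t ht
    have := ((((hasDerivAt_const t (-s * P (-s - 1) 0)).sub (e1.const_mul (-s))).div_const 6).add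
      (((dt t).div_const 6).mul (e2.const_mul (s * (s + 1))))).sub
      (((dt2 t).div_const 12).mul (e3.const_mul (-(s * (s + 1) * (s + 2)))))
    refine this.congr_deriv ?_
    simp only [hG3]; ring
  have b1 : ∀ t ∈ Set.Icc (0:ℝ) 1, ‖G1 t‖ ≤ M := by
    refine mv_step G1 G2 M (by simp [hG1]) (fun t ht => ?_) b2
    have e0 := dP (-s) (-s - 1) (by ring) t ht
    have e1 := dP (-s - 1) (-s - 2) (by ring) t ht
    have e2 := dP (-s - 2) (-s - 3) (by ring) t ht
    have := (((((hasDerivAt_const t (P (-s) 0)).sub e0).div_const 2).add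
      (((dt t).div_const 3).mul (e1.const_mul (-s)))).add
      (((dt t).div_const 6).mul_const (-s * P (-s - 1) 0))).sub
      (((dt2 t).div_const 12).mul (e2.const_mul (s * (s + 1))))
    refine this.congr_deriv ?_
    simp only [hG2]; ring
  have b0 : ∀ t ∈ Set.Icc (0:ℝ) 1, ‖G0 t‖ ≤ M := by
    refine mv_step G0 G1 M (by simp [hG0]) (fun t ht => ?_) b1
    have em := dP (1 - s) (-s) (by ring) t ht
    have e0 := dP (-s) (-s - 1) (by ring) t ht
    have e1 := dP (-s - 1) (-s - 2) (by ring) t ht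
    have := ((((dt t).div_const 2).mul ((hasDerivAt_const t (P (-s) 0)).add e0)).sub
      ((em.div_const (1 - s)).sub (hasDerivAt_const t (P (1 - s) 0 / (1 - s))))).sub
      (((dt2 t).div_const 12).mul ((e1.const_mul (-s)).sub (hasDerivAt_const t (-s * P (-s - 1) 0))))
    refine this.congr_deriv ?_
    simp only [hG1, Pi.add_apply, Pi.sub_apply]
    rw [mul_div_cancel_left₀ _ hs']
    ring
  have := b0 1 (Set.right_mem_Icc.2 zero_le_one)
  have hE : emD a s = G0 1 := by
    simp only [hG0, hP, emD, emF, add_zero, ofReal_one]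
    ring
  rwa [hE]

lemma emF_diff (a : ℝ) (ha : 0 < a) (s : ℂ) (hs : s ≠ 1) : DifferentiableAt ℂ (emF a) s := by
  have h0 : (a : ℂ) ≠ 0 := by exact_mod_cast ha.ne'
  have hs' : 1 - s ≠ 0 := sub_ne_zero.2 (Ne.symm hs)
  unfold emF
  refine DifferentiableAt.sub (DifferentiableAt.add (DifferentiableAt.div ?_ (by fun_prop) hs') ?_) ?_
  · exact DifferentiableAt.const_cpow (by fun_prop) (Or.inl h0)
  · exact (DifferentiableAt.const_cpow (by fun_prop) (Or.inl h0)).div_const _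
  · exact DifferentiableAt.mul (by fun_prop) (DifferentiableAt.const_cpow (by fun_prop) (Or.inl h0))

lemma emD_diff (a : ℝ) (ha : 0 < a) (s : ℂ) (hs : s ≠ 1) : DifferentiableAt ℂ (emD a) s := by
  unfold emD
  have h0 : ((a + 1 : ℝ) : ℂ) ≠ 0 := by exact_mod_cast (by linarith : a + 1 ≠ 0)
  exact ((DifferentiableAt.const_cpow (by fun_prop) (Or.inl h0)).sub
    (emF_diff _ (by linarith) s hs)).add (emF_diff _ ha s hs)

lemma emD_sum (s : ℂ) (n : ℕ) : ∑ i ∈ Finset.range n, emD ((i : ℝ) + 1) s =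
    ∑ k ∈ Finset.range (n + 1), (((k : ℝ) + 1 : ℝ) : ℂ) ^ (-s) - 1 - emF ((n : ℝ) + 1) s + emF 1 s := by
  induction n with
  | zero => simp
  | succ n ih =>
    rw [Finset.sum_range_succ, ih, Finset.sum_range_succ _ (n + 1), emD]
    push_cast
    ring

lemma emU_summable (σ : ℝ) (hσ : -3 < σ) (R : ℝ) :
    Summable (fun i : ℕ => R * ((i : ℝ) + 1) ^ (-σ - 4)) := by
  apply Summable.mul_left
  have := (summable_nat_add_iff 1).2 (Real.summable_nat_rpow (p := -σ - 4) |>.2 (by linarith))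
  simpa using this

lemma emD_summable (s : ℂ) (hs : s ≠ 1) (h3 : -3 < s.re) :
    Summable (fun i : ℕ => emD ((i : ℝ) + 1) s) :=
  Summable.of_norm_bounded (emU_summable s.re h3 ((‖s‖ + 3) ^ 4))
    (fun i => emD_bound _ (by simp) s hs _ _ le_rfl le_rfl h3)

lemma cpow_lim (c : ℂ) (hc : c.re < 0) :
    Tendsto (fun n : ℕ => (((n : ℝ) + 1 : ℝ) : ℂ) ^ c) atTop (𝓝 0) := by
  rw [tendsto_zero_iff_norm_tendsto_zero]
  have h : ∀ n : ℕ, ‖(((n : ℝ) + 1 : ℝ) : ℂ) ^ c‖ = ((n : ℝ) + 1) ^ (-(-c.re)) := fun n => by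
    rw [norm_cpow_eq_rpow_re_of_pos (by positivity), neg_neg]
  simp_rw [h]
  exact (tendsto_rpow_neg_atTop (by linarith)).comp
    (tendsto_atTop_add_const_right _ _ tendsto_natCast_atTop_atTop)

lemma zeta_eq_one (s : ℂ) (hs : 1 < s.re) :
    riemannZeta s = 1 - emF 1 s + ∑' i : ℕ, emD ((i : ℝ) + 1) s := by
  have hs1 : s ≠ 1 := by rintro rfl; simp at hs
  have h1 := (emD_summable s hs1 (by linarith)).hasSum.tendsto_sum_nat
  have hz : HasSum (fun k : ℕ => (((k : ℝ) + 1 : ℝ) : ℂ) ^ (-s)) (riemannZeta s) := by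
    rw [zeta_eq_tsum_one_div_nat_add_one_cpow hs]
    have : (fun k : ℕ => (((k : ℝ) + 1 : ℝ) : ℂ) ^ (-s)) = fun k : ℕ => 1 / ((k : ℂ) + 1) ^ s := by
      ext k; push_cast; rw [cpow_neg, one_div]
    rw [this]
    apply Summable.hasSum
    have := (summable_nat_add_iff 1).2 (Complex.summable_one_div_nat_cpow.2 hs)
    simpa using this
  have h2 := (hz.tendsto_sum_nat.comp (tendsto_add_atTop_nat 1))
  have h3 : Tendsto (fun n : ℕ => emF ((n : ℝ) + 1) s) atTop (𝓝 0) := by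
    have := (((cpow_lim (1 - s) (by simpa using hs)).div_const (1 - s)).add
      ((cpow_lim (-s) (by simp; linarith)).div_const 2)).sub
      ((cpow_lim (-s - 1) (by simp; linarith)).const_mul (s / 12))
    simpa [emF] using this
  have h4 := ((h2.sub_const 1).sub h3).add_const (emF 1 s)
  have h5 := tendsto_nhds_unique h1 (h4.congr fun n => (emD_sum s n).symm)
  rw [h5]; ring

lemma zeta_eq_two (s₀ : ℝ) (h3 : -3 < s₀) (h1 : s₀ < 1) :
    riemannZeta (s₀ : ℂ) = 1 - emF 1 s₀ + ∑' i : ℕ, emD ((i : ℝ) + 1) s₀ := by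
  obtain ⟨σ, hσ3, hσ⟩ := exists_between h3
  set U1 : Set ℂ := Set.Ioo 1 3 ×ℂ Set.Ioo (-1) 1 with hU1
  set U2 : Set ℂ := Set.Ioo σ 3 ×ℂ Set.Ioo 0 1 with hU2
  set U3 : Set ℂ := Set.Ioo σ 1 ×ℂ Set.Ioo (-1) 1 with hU3
  have hpre : ∀ a b c d : ℝ, IsPreconnected (Set.Ioo a b ×ℂ Set.Ioo c d) := fun a b c d =>
    by
    have : Set.Ioo a b ×ℂ Set.Ioo c d = Set.preimage Complex.reLm (Set.Ioo a b) ∩ Set.preimage Complex.imLm (Set.Ioo c d) := rfl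
    rw [this]
    exact (((convex_Ioo a b).linear_preimage reLm).inter
      ((convex_Ioo c d).linear_preimage imLm)).isPreconnected
  have hop : ∀ a b c d : ℝ, IsOpen (Set.Ioo a b ×ℂ Set.Ioo c d) := fun a b c d =>
    isOpen_Ioo.reProdIm isOpen_Ioo
  set U : Set ℂ := U1 ∪ U2 ∪ U3 with hU
  have hUo : IsOpen U := ((hop _ _ _ _).union (hop _ _ _ _)).union (hop _ _ _ _)
  have hUp : IsPreconnected U := by
    refine IsPreconnected.union (⟨(σ + 1) / 2, 1 / 2⟩ : ℂ) (Or.inr ?_) ?_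
      (IsPreconnected.union (⟨2, 1 / 2⟩ : ℂ) ?_ ?_ (hpre _ _ _ _) (hpre _ _ _ _)) (hpre _ _ _ _)
    · rw [hU2, mem_reProdIm]; refine ⟨⟨?_, ?_⟩, ⟨?_, ?_⟩⟩ <;> simp <;> linarith
    · rw [hU3, mem_reProdIm]; refine ⟨⟨?_, ?_⟩, ⟨?_, ?_⟩⟩ <;> simp <;> linarith
    · rw [hU1, mem_reProdIm]; refine ⟨⟨?_, ?_⟩, ⟨?_, ?_⟩⟩ <;> norm_num
    · rw [hU2, mem_reProdIm]; refine ⟨⟨?_, ?_⟩, ⟨?_, ?_⟩⟩ <;> norm_num; linarith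
  have hUb : ∀ s ∈ U, s ≠ 1 ∧ σ ≤ s.re ∧ ‖s‖ + 3 ≤ 7 := by
    rintro s ((hs | hs) | hs) <;> rw [mem_reProdIm] at hs <;> obtain ⟨⟨h1, h2⟩, h3, h4⟩ := hs <;>
    refine ⟨?_, by linarith, ?_⟩
    all_goals first
      | (rintro rfl; simp at *)
      | (have := norm_le_abs_re_add_abs_im s
         have e1 : |s.re| ≤ 3 := abs_le.2 ⟨by linarith, by linarith⟩
         have e2 : |s.im| ≤ 1 := abs_le.2 ⟨by linarith, by linarith⟩
         linarith)
  have hA : AnalyticOnNhd ℂ riemannZeta U := DifferentiableOn.analyticOnNhd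
    (fun s hs => (differentiableAt_riemannZeta (hUb s hs).1).differentiableWithinAt) hUo
  have hB : AnalyticOnNhd ℂ (fun s => 1 - emF 1 s + ∑' i : ℕ, emD ((i : ℝ) + 1) s) U := by
    refine DifferentiableOn.analyticOnNhd ?_ hUo
    refine DifferentiableOn.add (fun s hs => ?_) ?_
    · exact ((emF_diff 1 one_pos s (hUb s hs).1).const_sub 1).differentiableWithinAt
    · refine differentiableOn_tsum_of_summable_norm (emU_summable σ hσ3 (7 ^ 4)) (fun i s hs => ?_) hUo
        (fun i s hs => ?_)
      · exact (emD_diff _ (by positivity) s (hUb s hs).1).differentiableWithinAt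
      · exact emD_bound _ (by simp) s (hUb s hs).1 _ _ (hUb s hs).2.2 (hUb s hs).2.1 hσ3
  have h2U1 : (2 : ℂ) ∈ U1 := by
    rw [hU1, mem_reProdIm]; refine ⟨⟨?_, ?_⟩, ⟨?_, ?_⟩⟩ <;> norm_num
  have key := hA.eqOn_of_preconnected_of_eventuallyEq hB hUp (z₀ := 2) (Or.inl (Or.inl h2U1))
    (by
      filter_upwards [(hop 1 3 (-1) 1).mem_nhds h2U1] with s hs
      exact zeta_eq_one s (mem_reProdIm.1 hs).1.1)
  refine key (Or.inr ?_)
  rw [hU3, mem_reProdIm]; refine ⟨⟨?_, ?_⟩, ⟨?_, ?_⟩⟩ <;> simp <;> linarith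

lemma v_step (α : ℝ) (h0 : 0 < α) (h1 : α < 1) (a : ℝ) (ha : 1 ≤ a) :
    a ^ (α - 2) ≤ 4 / (1 - α) * (a ^ (α - 1) - (a + 1) ^ (α - 1)) := by
  obtain ⟨c, hc, hc'⟩ := exists_hasDerivAt_eq_slope (fun t : ℝ => t ^ (α - 1))
    (fun t => (α - 1) * t ^ (α - 2)) (lt_add_one a)
    (fun t ht => (Real.continuousAt_rpow_const _ _ (Or.inl (by linarith [ht.1]))).continuousWithinAt)
    (fun t ht => by
      have := Real.hasDerivAt_rpow_const (x := t) (p := α - 1) (Or.inl (by linarith [ht.1]))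
      rwa [show α - 1 - 1 = α - 2 by ring] at this)
  have e1 : (a + 1) ^ (α - 1) - a ^ (α - 1) = (α - 1) * c ^ (α - 2) := by
    rw [hc']; simp
  have e2 : (2 * a) ^ (α - 2) ≤ c ^ (α - 2) :=
    Real.rpow_le_rpow_of_nonpos (by linarith [hc.1]) (by linarith [hc.2]) (by linarith)
  have e3 : (1 / 4 : ℝ) ≤ 2 ^ (α - 2) := by
    calc (1 / 4 : ℝ) = 2 ^ (-2 : ℝ) := by
          rw [Real.rpow_neg (by norm_num)]; norm_num
      _ ≤ _ := Real.rpow_le_rpow_of_exponent_le (by norm_num) (by linarith)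
  rw [Real.mul_rpow (by norm_num) (by linarith)] at e2
  have e4 : 0 < a ^ (α - 2) := Real.rpow_pos_of_pos (by linarith) _
  have e5 : a ^ (α - 1) - (a + 1) ^ (α - 1) = (1 - α) * c ^ (α - 2) := by linarith
  rw [e5, ← mul_assoc, div_mul_cancel₀ _ (by linarith)]
  nlinarith

lemma tail_bound (α : ℝ) (h0 : 0 < α) (h1 : α < 1) :
    ∃ K > 0, ∀ n : ℕ, ‖∑ k ∈ Finset.range (n + 1), (((k : ℝ) + 1 : ℝ) : ℂ) ^ (-((-2 - α : ℝ) : ℂ))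
      - emF ((n : ℝ) + 1) ((-2 - α : ℝ) : ℂ) - riemannZeta ((-2 - α : ℝ) : ℂ)‖
      ≤ K * ((n : ℝ) + 1) ^ (α - 1) := by
  set s : ℂ := ((-2 - α : ℝ) : ℂ) with hs
  have hre : s.re = -2 - α := by simp only [hs, ofReal_re]
  have hs1 : s ≠ 1 := by
    intro h; rw [h] at hre; simp at hre; linarith
  have hR : 0 < ‖s‖ + 3 := by positivity
  have h1α : 0 < 1 - α := by linarith
  set e : ℕ → ℂ := fun n => ∑ k ∈ Finset.range (n + 1), (((k : ℝ) + 1 : ℝ) : ℂ) ^ (-s)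
      - emF ((n : ℝ) + 1) s - riemannZeta s with he
  set K : ℝ := (‖s‖ + 3) ^ 4 * (4 / (1 - α)) with hK
  have hKpos : 0 < K := by positivity
  have hz := zeta_eq_two (-2 - α) (by linarith) (by linarith)
  rw [← hs] at hz
  have hlim : Tendsto e atTop (𝓝 0) := by
    have h1 := (emD_summable s hs1 (by rw [hre]; linarith)).hasSum.tendsto_sum_nat
    have h2 := h1.sub_const (∑' i : ℕ, emD ((i : ℝ) + 1) s)
    rw [sub_self] at h2
    refine h2.congr fun n => ?_
    rw [emD_sum]
    simp only [he, hz]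
    ring
  have hstep : ∀ n, ‖e (n + 1) - e n‖ ≤ K * (((n : ℝ) + 1) ^ (α - 1) - ((n : ℝ) + 1 + 1) ^ (α - 1)) := by
    intro n
    have : e (n + 1) - e n = emD ((n : ℝ) + 1) s := by
      simp only [he, emD]
      rw [Finset.sum_range_succ _ (n + 1)]
      push_cast
      ring
    rw [this]
    refine (emD_bound _ (by simp) s hs1 (‖s‖ + 3) s.re le_rfl le_rfl (by rw [hre]; linarith)).trans ?_
    rw [hre, hK, mul_assoc, show -(-2 - α) - 4 = α - 2 by ring]
    gcongr
    exact v_step α h0 h1 _ (by simp)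
  refine ⟨K, hKpos, fun n => ?_⟩
  change ‖e n‖ ≤ _
  have hind : ∀ m : ℕ, ‖e n‖ ≤ ‖e (m + n)‖ + K * ((n : ℝ) + 1) ^ (α - 1) := by
    have : ∀ m : ℕ, ‖e n‖ ≤ ‖e (m + n)‖ +
        K * (((n : ℝ) + 1) ^ (α - 1) - (((m + n : ℕ) : ℝ) + 1) ^ (α - 1)) := by
      intro m
      induction m with
      | zero => simp
      | succ m ih =>
        have a1 := hstep (m + n)
        have a2 := norm_sub_norm_le (e (m + n)) (e (m + n + 1))
        rw [norm_sub_rev (e (m + n)) (e (m + n + 1))] at a2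
        rw [show m + 1 + n = m + n + 1 by ring, Nat.cast_succ (m + n)]
        linarith
    intro m
    have p : 0 ≤ K * (((m + n : ℕ) : ℝ) + 1) ^ (α - 1) := by positivity
    linarith [this m]
  have hl : Tendsto (fun m => ‖e (m + n)‖ + K * ((n : ℝ) + 1) ^ (α - 1)) atTop
      (𝓝 (0 + K * ((n : ℝ) + 1) ^ (α - 1))) := by
    refine Tendsto.add_const _ ?_
    have := (hlim.comp (tendsto_add_atTop_nat n)).norm
    simpa using this
  rw [zero_add] at hl
  exact ge_of_tendsto' hl hind

theorem trapezoid_expansion_pow_two_add_alpha (α x : ℝ) (hα0 : 0 < α) (hα1 : α < 1)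
    (hx : 0 < x) :
    ∃ C > 0, ∀ N : ℕ, 0 < N → ∀ h : ℝ, h = x / N →
      |h ^ (3 + α) * (∑ k ∈ Finset.Icc 1 N, (k : ℝ) ^ (2 + α)) -
          (x ^ (2 + α) / 2) * h -
        (x ^ (3 + α) / (3 + α) + ((2 + α) * x ^ (1 + α) / 12) * h ^ 2 +
          zetaR (-2 - α) * h ^ (3 + α))| ≤ C * h ^ 4 := by
  obtain ⟨K, hK, hb⟩ := tail_bound α hα0 hα1
  refine ⟨K * x ^ (α - 1), by positivity, ?_⟩
  intro N hN h hh
  obtain ⟨n, rfl⟩ : ∃ n, N = n + 1 := ⟨N - 1, by omega⟩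
  have hb := hb n
  set a : ℝ := (n : ℝ) + 1 with ha
  have ha0 : 0 < a := by positivity
  push_cast at hh
  rw [← ha] at hh
  have hh0 : 0 < h := by rw [hh]; positivity
  have hxa : x = h * a := by rw [hh]; field_simp
  set S : ℝ := ∑ k ∈ Finset.Icc 1 (n + 1), (k : ℝ) ^ (2 + α) with hS
  have hcp : ∀ b : ℝ, 0 < b → ∀ p : ℝ, ∀ c : ℂ, c = (p : ℂ) → (b : ℂ) ^ c = ((b ^ p : ℝ) : ℂ) := by
    rintro b hb p c rfl
    rw [ofReal_cpow hb.le]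
  have eS : ∑ k ∈ Finset.range (n + 1), (((k : ℝ) + 1 : ℝ) : ℂ) ^ (-((-2 - α : ℝ) : ℂ)) = (S : ℂ) := by
    rw [hS, show Finset.Icc 1 (n + 1) = Finset.Ico 1 (n + 1 + 1) from rfl, Finset.sum_Ico_eq_sum_range]
    simp only [Nat.add_sub_cancel, add_comm 1]
    push_cast
    refine Finset.sum_congr rfl fun k _ => ?_
    have := hcp ((k : ℝ) + 1) (by positivity) (2 + α) (-((-2 - α : ℝ) : ℂ)) (by push_cast; ring)
    push_cast at this
    exact this
  have eF : emF a ((-2 - α : ℝ) : ℂ) = ((a ^ (3 + α) / (3 + α) + a ^ (2 + α) / 2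
      + (2 + α) / 12 * a ^ (1 + α) : ℝ) : ℂ) := by
    rw [emF, hcp a ha0 (3 + α) _ (by push_cast; ring), hcp a ha0 (2 + α) _ (by push_cast; ring),
      hcp a ha0 (1 + α) _ (by push_cast; ring)]
    push_cast
    ring
  rw [eS, eF] at hb
  have hre := (abs_re_le_norm _).trans hb
  rw [sub_re, sub_re, ofReal_re, ofReal_re] at hre
  change |S - _ - zetaR (-2 - α)| ≤ _ at hre
  set Z := zetaR (-2 - α)
  have x3 : x ^ (3 + α) = h ^ (3 + α) * a ^ (3 + α) := by
    rw [hxa, Real.mul_rpow hh0.le ha0.le]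
  have x2 : x ^ (2 + α) * h = h ^ (3 + α) * a ^ (2 + α) := by
    rw [hxa, Real.mul_rpow hh0.le ha0.le, show 3 + α = 2 + α + 1 by ring,
      Real.rpow_add_one hh0.ne']; ring
  have x1 : x ^ (1 + α) * h ^ 2 = h ^ (3 + α) * a ^ (1 + α) := by
    rw [hxa, Real.mul_rpow hh0.le ha0.le, show 3 + α = 1 + α + 1 + 1 by ring,
      Real.rpow_add_one hh0.ne', Real.rpow_add_one hh0.ne']; ring
  have x4 : x ^ (α - 1) * h ^ 4 = h ^ (3 + α) * a ^ (α - 1) := by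
    rw [hxa, Real.mul_rpow hh0.le ha0.le, show 3 + α = α - 1 + (4 : ℕ) by push_cast; ring,
      Real.rpow_add_natCast hh0.ne']; ring
  have hfin : h ^ (3 + α) * S - (x ^ (2 + α) / 2) * h -
        (x ^ (3 + α) / (3 + α) + ((2 + α) * x ^ (1 + α) / 12) * h ^ 2 + Z * h ^ (3 + α))
      = h ^ (3 + α) * (S - (a ^ (3 + α) / (3 + α) + a ^ (2 + α) / 2
      + (2 + α) / 12 * a ^ (1 + α)) - Z) := by
    rw [x3]
    linear_combination (-1 / 2 : ℝ) * x2 - (2 + α) / 12 * x1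
  have hhp : 0 < h ^ (3 + α) := by positivity
  rw [hfin, abs_mul, abs_of_pos hhp, mul_assoc, x4]
  calc _ ≤ h ^ (3 + α) * (K * a ^ (α - 1)) := by gcongr
    _ = _ := by ring
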